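/- Let n ≥ 2. The elements c^0_{12}, c^0_{23}, …, c^0_{(n−1)n} and c^1_{n1} of I_n are cycles (∂ of each is 0), and the cohomology H(I_n) is generated as a k_n-algebra by their cohomology classes. -/

import Mathlib

/-!
Internal DG-algebra of Ekholm–Ng. Fix a field `K`, `n ≥ 1` and integers `m : Fin n → ℤ`.
`IAlg K n` is the free associative `k_n`-algebra on generators `c^p_{ij}` (with
`c^0_{ij} = 0` for `i ≥ j`), realised as a quotient of the free `K`-algebra on the
generators together with the orthogonal idempotents `e i` spanning `k_n`.
-/

namespace InternalAlgebra

inductive IGen (n : ℕ) : Type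
  | e (i : Fin n) : IGen n
  | c (p : ℕ) (i j : Fin n) : IGen n

open IGen

variable (K : Type) [Field K] (n : ℕ)

/-- Relations defining the free `k_n`-algebra on the generators `c^p_{ij}`:
the `e i` are orthogonal idempotents summing to `1`, each `c^p_{ij}` satisfies
`e j * c^p_{ij} = c^p_{ij} = c^p_{ij} * e i`, and `c^0_{ij} = 0` unless `i < j`. -/
inductive Rel : FreeAlgebra K (IGen n) → FreeAlgebra K (IGen n) → Prop
  | idem (i : Fin n) :
      Rel (FreeAlgebra.ι K (e i) * FreeAlgebra.ι K (e i)) (FreeAlgebra.ι K (e i))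
  | orth (i j : Fin n) (h : i ≠ j) :
      Rel (FreeAlgebra.ι K (e i) * FreeAlgebra.ι K (e j)) 0
  | total : Rel (∑ i : Fin n, FreeAlgebra.ι K (e i)) 1
  | left (p : ℕ) (i j : Fin n) :
      Rel (FreeAlgebra.ι K (e j) * FreeAlgebra.ι K (c p i j)) (FreeAlgebra.ι K (c p i j))
  | right (p : ℕ) (i j : Fin n) :
      Rel (FreeAlgebra.ι K (c p i j) * FreeAlgebra.ι K (e i)) (FreeAlgebra.ι K (c p i j))
  | czero (i j : Fin n) (h : ¬ i < j) : Rel (FreeAlgebra.ι K (c 0 i j)) 0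

/-- The internal algebra `I_n` (as a `K`-algebra; the `k_n`-structure is spanned by
the images of the idempotents `e i`). -/
abbrev IAlg := RingQuot (Rel K n)

/-- The image of a generator in `I_n`. -/
def ι (g : IGen n) : IAlg K n := RingQuot.mkAlgHom K (Rel K n) (FreeAlgebra.ι K g)

variable (m : Fin n → ℤ)

/-- Degrees of the generators: `|e i| = 0`, `|c^p_{ij}| = 1 - 2p + m j - m i`. -/
def dg : IGen n → ℤ
  | e _ => 0
  | c p i j => 1 - 2 * (p : ℤ) + m j - m i

/-- The homogeneous component of degree `d`: the `K`-span of products of generators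
whose degrees sum to `d`. -/
def Hgr (d : ℤ) : Submodule K (IAlg K n) :=
  Submodule.span K
    { x | ∃ l : List (IGen n), (l.map (dg n m)).sum = d ∧ x = (l.map (ι K n)).prod }

/-- `(-1)^d` as an element of `K`. -/
def sgn (d : ℤ) : K := if Even d then 1 else -1

/-- The prescribed values of the differential on the generators. -/
def Dval : IGen n → IAlg K n
  | e _ => 0
  | c 0 i j =>
      ∑ r : Fin n,
        if i < r ∧ r < j then
          sgn K (m r + m j) • (ι K n (c 0 r j) * ι K n (c 0 i r)) else 0
  | c 1 i j =>
      (if i = j then ι K n (e i) else 0)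
      + ∑ r : Fin n,
          ((if i < r then sgn K (m r + m j) • (ι K n (c 1 r j) * ι K n (c 0 i r)) else 0)
            + (if r < j then sgn K (m r + m j) • (ι K n (c 0 r j) * ι K n (c 1 i r)) else 0))
  | c (p + 2) i j =>
      ∑ q ∈ Finset.range (p + 3), ∑ r : Fin n,
        sgn K (m r + m j) • (ι K n (c (p + 2 - q) r j) * ι K n (c q i r))

/-- The subalgebra `A_n` generated over `k_n` by the `c^0_{ij}` and `c^1_{ij}`. -/
def Asub : Subalgebra K (IAlg K n) :=
  Algebra.adjoin K
    ({x | ∃ i, x = ι K n (e i)} ∪ {x | ∃ i j, x = ι K n (c 0 i j)}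
      ∪ {x | ∃ i j, x = ι K n (c 1 i j)})

/-- `D` vanishes on `k_n`, takes the prescribed values on the generators, and satisfies
the graded Leibniz rule. -/
def IsDiff (D : IAlg K n →ₗ[K] IAlg K n) : Prop :=
  (∀ i : Fin n, D (ι K n (e i)) = 0) ∧
  (∀ (p : ℕ) (i j : Fin n), D (ι K n (c p i j)) = Dval K n m (c p i j)) ∧
  (∀ (d : ℤ) (a b : IAlg K n), a ∈ Hgr K n m d →
    D (a * b) = D a * b + sgn K d • (a * D b))

end InternalAlgebra

open InternalAlgebra InternalAlgebra.IGen

namespace InternalAlgebra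

section Relations

variable (K : Type) [Field K] (n : ℕ)

theorem e_mul_e_self (i : Fin n) : ι K n (e i) * ι K n (e i) = ι K n (e i) := by
  simpa [ι] using RingQuot.mkAlgHom_rel K (Rel.idem (K := K) i)

theorem e_mul_e_of_ne {i j : Fin n} (h : i ≠ j) : ι K n (e i) * ι K n (e j) = 0 := by
  simpa [ι] using RingQuot.mkAlgHom_rel K (Rel.orth (K := K) i j h)

theorem sum_e : ∑ i : Fin n, ι K n (e i) = 1 := by
  simpa [ι] using RingQuot.mkAlgHom_rel K (Rel.total (K := K) (n := n))

theorem e_mul_c (p : ℕ) (i j : Fin n) :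
    ι K n (e j) * ι K n (c p i j) = ι K n (c p i j) := by
  simpa [ι] using RingQuot.mkAlgHom_rel K (Rel.left (K := K) p i j)

theorem c_mul_e (p : ℕ) (i j : Fin n) :
    ι K n (c p i j) * ι K n (e i) = ι K n (c p i j) := by
  simpa [ι] using RingQuot.mkAlgHom_rel K (Rel.right (K := K) p i j)

theorem c_zero_of_not_lt {i j : Fin n} (h : ¬ i < j) : ι K n (c 0 i j) = 0 := by
  simpa [ι] using RingQuot.mkAlgHom_rel K (Rel.czero (K := K) i j h)

theorem adjoin_range_ι : Algebra.adjoin K (Set.range (ι K n)) = ⊤ := by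
  have h : Set.range (ι K n) =
      (RingQuot.mkAlgHom K (Rel K n)) '' Set.range (FreeAlgebra.ι K) := by
    rw [← Set.range_comp]; rfl
  rw [h, Algebra.adjoin_image, FreeAlgebra.adjoin_range_ι, Algebra.map_top,
    AlgHom.range_eq_top]
  exact RingQuot.mkAlgHom_surjective K _

/-- The map on generators underlying the Fox-type derivation `exists_fox`. -/
def foxGen (π : Equiv.Perm (Fin n)) (f : ℕ → Fin n → Fin n → IAlg K n) :
    IGen n → Matrix (Fin 2) (Fin 2) (IAlg K n)
  | e i => !![ι K n (e (π i)), 0; 0, ι K n (e i)]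
  | c p i j => !![0, f p i j; 0, ι K n (c p i j)]

/-- A linear map that replaces the leftmost generator of a word. -/
theorem exists_fox (π : Equiv.Perm (Fin n)) (f : ℕ → Fin n → Fin n → IAlg K n)
    (hl : ∀ p i j, ι K n (e (π j)) * f p i j = f p i j)
    (hr : ∀ p i j, f p i j * ι K n (e i) = f p i j)
    (h0 : ∀ i j, ¬ i < j → f 0 i j = 0) :
    ∃ L : IAlg K n →ₗ[K] IAlg K n,
      (∀ i, L (ι K n (e i)) = 0) ∧
      (∀ i y, L (ι K n (e i) * y) = ι K n (e (π i)) * L y) ∧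
      (∀ p i j y, L (ι K n (c p i j) * y) = f p i j * y) := by
  let g : FreeAlgebra K (IGen n) →ₐ[K] Matrix (Fin 2) (Fin 2) (IAlg K n) :=
    FreeAlgebra.lift K (foxGen K n π f)
  have hg : ∀ x, g (FreeAlgebra.ι K x) = foxGen K n π f x := fun x =>
    FreeAlgebra.lift_ι_apply _ _
  have hrel : ∀ ⦃x y⦄, Rel K n x y → g x = g y := by
    intro x y h
    induction h with
    | idem i => simp [hg, foxGen, e_mul_e_self]
    | orth i j h =>
      have h' : π i ≠ π j := fun H => h (π.injective H)
      simp only [map_mul, hg, foxGen, map_zero]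
      ext a b; fin_cases a <;> fin_cases b <;>
        simp [e_mul_e_of_ne K n h, e_mul_e_of_ne K n h']
    | total =>
      simp only [map_sum, hg, foxGen, map_one]
      have := Equiv.sum_comp π (fun i => ι K n (e i))
      ext a b; fin_cases a <;> fin_cases b <;>
        simp [Matrix.sum_apply, sum_e, this]
    | left p i j => simp [hg, foxGen, e_mul_c, hl]
    | right p i j => simp [hg, foxGen, c_mul_e, hr]
    | czero i j h =>
      simp only [hg, foxGen, map_zero, h0 i j h, c_zero_of_not_lt K n h]
      ext a b; fin_cases a <;> fin_cases b <;> simp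
  let G : IAlg K n →ₐ[K] Matrix (Fin 2) (Fin 2) (IAlg K n) :=
    RingQuot.liftAlgHom K ⟨g, hrel⟩
  have hG : ∀ x, G (ι K n x) = foxGen K n π f x := fun x => by
    rw [← hg]; exact RingQuot.liftAlgHom_mkAlgHom_apply K _ _ _
  have h11 : ∀ y, G y 1 0 = 0 ∧ G y 1 1 = y := by
    intro y
    have hy : y ∈ Algebra.adjoin K (Set.range (ι K n)) := by
      rw [adjoin_range_ι]; trivial
    induction hy using Algebra.adjoin_induction with
    | mem x hx =>
      obtain ⟨x, rfl⟩ := hx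
      rw [hG]; cases x <;> simp [foxGen]
    | algebraMap r => simp [Matrix.algebraMap_matrix_apply]
    | add x y _ _ hx hy => simp [hx, hy]
    | mul x y _ _ hx hy => simp [Matrix.mul_apply, hx, hy]
  refine ⟨(Matrix.entryLinearMap K (IAlg K n) 0 1) ∘ₗ G.toLinearMap, ?_, ?_, ?_⟩
  · intro i; simp [hG, foxGen]
  · intro i y; simp [hG, foxGen, Matrix.mul_apply, Fin.sum_univ_two, -Matrix.cons_mul]
  · intro p i j y; simp [hG, foxGen, Matrix.mul_apply, Fin.sum_univ_two, h11, -Matrix.cons_mul]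

end Relations

section Cyclic

variable (K : Type) [Field K] (n : ℕ) [NeZero n]

/-- The idempotent at the vertex `a` modulo `n`. -/
def E (a : ℕ) : IAlg K n := ι K n (e (Fin.ofNat n a))

/-- The generator attached to the path from `a` to `b` winding around the cyclic quiver with
`n` vertices: `c^p_{ij}` is the path from `i` to `j + n * p`. -/
def X (a b : ℕ) : IAlg K n := ι K n (c (b / n - a / n) (Fin.ofNat n a) (Fin.ofNat n b))

variable {n} in
theorem ofNat_add_mul (a k : ℕ) : Fin.ofNat n (a + n * k) = Fin.ofNat n a := by
  ext; simp

variable {n} in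
theorem ofNat_add_self (a : ℕ) : Fin.ofNat n (a + n) = Fin.ofNat n a := by
  simpa using ofNat_add_mul (n := n) a 1

theorem E_shift (a : ℕ) : E K n (a + n) = E K n a := by
  rw [E, ofNat_add_self, E]

theorem X_shift (a b k : ℕ) : X K n (a + n * k) (b + n * k) = X K n a b := by
  have hn : 0 < n := Nat.pos_of_neZero n
  rw [X, X, ofNat_add_mul, ofNat_add_mul, Nat.add_mul_div_left _ _ hn,
    Nat.add_mul_div_left _ _ hn, Nat.add_sub_add_right]

theorem X_val (p : ℕ) (i j : Fin n) : X K n i (j + n * p) = ι K n (c p i j) := by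
  have hn : 0 < n := Nat.pos_of_neZero n
  rw [X, ofNat_add_mul, Nat.add_mul_div_left _ _ hn, Nat.div_eq_of_lt i.2, Nat.div_eq_of_lt j.2]
  simp

theorem E_val (i : Fin n) : E K n i = ι K n (e i) := by
  simp [E]

theorem E_mul_X (a b : ℕ) : E K n b * X K n a b = X K n a b := e_mul_c ..

theorem X_mul_E (a b : ℕ) : X K n a b * E K n a = X K n a b := c_mul_e ..

theorem E_mul_X_mul (a b : ℕ) (y : IAlg K n) : E K n b * (X K n a b * y) = X K n a b * y := by
  rw [← mul_assoc, E_mul_X]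

/-- Merging with a path of length one: the leftmost generator of a word is lengthened. -/
theorem exists_raise : ∃ R : IAlg K n →ₗ[K] IAlg K n,
    (∀ i, R (ι K n (e i)) = 0) ∧
    (∀ a y, R (E K n a * y) = E K n (a + 1) * R y) ∧
    (∀ a b y, a < b → R (X K n a b * y) = X K n a (b + 1) * y) := by
  have hn : 0 < n := Nat.pos_of_neZero n
  obtain ⟨R, h1, h2, h3⟩ := exists_fox K n (Equiv.addRight 1)
    (fun p i j => if p = 0 ∧ ¬ i < j then 0 else X K n i (j + n * p + 1))
    (by
      intro p i j
      split_ifs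
      · simp
      · have : ι K n (e (Equiv.addRight 1 j)) = E K n (j + n * p + 1) := by
          rw [E, show (j : ℕ) + n * p + 1 = j + 1 + n * p by ring, ofNat_add_mul]
          congr 2
          ext
          simp [Fin.val_add]
        rw [this, E_mul_X])
    (by
      intro p i j
      split_ifs
      · simp
      · rw [← E_val, X_mul_E])
    (by intro i j h; simp [h])
  refine ⟨R, h1, ?_, ?_⟩
  · intro a y
    rw [E, h2, E]
    congr 3
    ext
    simp [Fin.val_add]
  · intro a b y hab
    rw [X, h3]
    have hdiv : a / n ≤ b / n := Nat.div_le_div_right hab.le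
    have ha := Nat.mod_add_div a n
    have hb := Nat.mod_add_div b n
    rw [if_neg]
    · have h := X_shift K n (a % n) (b % n + n * (b / n - a / n) + 1) (a / n)
      rw [show b % n + n * (b / n - a / n) + 1 + n * (a / n)
          = b % n + n * (b / n - a / n + a / n) + 1 by ring, Nat.sub_add_cancel hdiv, ha, hb] at h
      rw [h]; simp
    · rintro ⟨h, h'⟩
      have : a / n = b / n := by omega
      rw [this] at ha
      simp only [Fin.lt_def, Fin.val_ofNat] at h'
      omega

/-- Removal of a leftmost generator of length one, weighted by `s`. -/
theorem exists_strip (s : Fin n → K) : ∃ S : IAlg K n →ₗ[K] IAlg K n,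
    (∀ i, S (ι K n (e i)) = 0) ∧
    (∀ a b y, a < b → S (X K n a b * y) =
      if b = a + 1 then s (Fin.ofNat n a) • (E K n a * y) else 0) := by
  have hn : 0 < n := Nat.pos_of_neZero n
  obtain ⟨S, h1, h2, h3⟩ := exists_fox K n (Equiv.addRight 1).symm
    (fun p i j => if (j : ℕ) + n * p = i + 1 then s i • ι K n (e i) else 0)
    (by
      intro p i j
      split_ifs with h
      · have : (Equiv.addRight 1).symm j = i := by
          rw [Equiv.symm_apply_eq]
          ext
          have := congrArg (· % n) h
          simpa [Fin.val_add, Nat.mod_eq_of_lt j.2] using this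
        rw [this, mul_smul_comm, e_mul_e_self]
      · simp)
    (by
      intro p i j
      split_ifs
      · rw [smul_mul_assoc, e_mul_e_self]
      · simp)
    (by
      intro i j h
      rw [if_neg]
      simp only [Fin.lt_def] at h
      omega)
  refine ⟨S, h1, ?_⟩
  · intro a b y hab
    rw [X, h3]
    have hdiv : a / n ≤ b / n := Nat.div_le_div_right hab.le
    have ha := Nat.mod_add_div a n
    have hb := Nat.mod_add_div b n
    have : n * (b / n - a / n) + n * (a / n) = n * (b / n) := by
      rw [← mul_add, Nat.sub_add_cancel hdiv]
    simp only [Fin.val_ofNat]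
    by_cases h : b = a + 1
    · rw [if_pos h, if_pos (by omega), smul_mul_assoc, E]
    · rw [if_neg h, if_neg (by omega), zero_mul]

/-- Words of total length at most `w` in the generators `X`. -/
inductive Word : ℕ → IAlg K n → Prop
  | idem (w : ℕ) (i : Fin n) : Word w (ι K n (e i))
  | mul {w w' a b : ℕ} {u : IAlg K n} (hab : a < b) (hw : w + b ≤ w' + a) (hu : Word w u) :
      Word w' (X K n a b * u)

/-- The increasing filtration of the internal algebra by total path length. -/
def Filt (w : ℕ) : Submodule K (IAlg K n) := Submodule.span K {u | Word K n w u}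

variable {K n}

theorem Word.mono {w w' : ℕ} {u : IAlg K n} (h : w ≤ w') (hu : Word K n w u) :
    Word K n w' u := by
  cases hu with
  | idem => exact .idem _ _
  | mul hab hw hu => exact .mul hab (by omega) hu

theorem Word.mem {w : ℕ} {u : IAlg K n} (hu : Word K n w u) : u ∈ Filt K n w :=
  Submodule.subset_span hu

theorem Filt.mono {w w' : ℕ} (h : w ≤ w') : Filt K n w ≤ Filt K n w' :=
  Submodule.span_mono fun _ hu => Word.mono h hu

theorem map_mem_of_word {w : ℕ} (L : IAlg K n →ₗ[K] IAlg K n) {P : Submodule K (IAlg K n)}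
    (h : ∀ u, Word K n w u → L u ∈ P) {x : IAlg K n} (hx : x ∈ Filt K n w) : L x ∈ P := by
  have : Filt K n w ≤ P.comap L := Submodule.span_le.2 h
  exact this hx

theorem E_mul_mem {w : ℕ} (a : ℕ) {x : IAlg K n} (hx : x ∈ Filt K n w) :
    E K n a * x ∈ Filt K n w := by
  refine map_mem_of_word (LinearMap.mulLeft K (E K n a)) (fun u hu => ?_) hx
  have key : ∀ i : Fin n, ι K n (e i) * u = u → E K n a * u ∈ Filt K n w := by
    intro i hi
    by_cases h : Fin.ofNat n a = i
    · rw [E, h, hi]; exact hu.mem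
    · rw [← hi, ← mul_assoc, E, e_mul_e_of_ne K n h, zero_mul]; exact zero_mem _
  cases hu with
  | idem _ i => exact key i (e_mul_e_self ..)
  | mul hab hw hu => exact key _ (E_mul_X_mul ..)

theorem X_mul_mem {w w' a b : ℕ} (hab : a < b) (hw : w + b ≤ w' + a) {x : IAlg K n}
    (hx : x ∈ Filt K n w) : X K n a b * x ∈ Filt K n w' :=
  map_mem_of_word (LinearMap.mulLeft K (X K n a b)) (fun _ hu => (Word.mul hab hw hu).mem) hx

theorem ι_mul_mem {w : ℕ} (g : IGen n) {x : IAlg K n} (hx : x ∈ Filt K n w) :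
    ∃ w', ι K n g * x ∈ Filt K n w' := by
  cases g with
  | e i => exact ⟨w, by rw [← E_val]; exact E_mul_mem _ hx⟩
  | c p i j =>
    by_cases h : (i : ℕ) < j + n * p
    · exact ⟨w + (j + n * p), by rw [← X_val]; exact X_mul_mem h (by omega) hx⟩
    · have hp : p = 0 := by
        by_contra hp
        have := Nat.le_mul_of_pos_right n (Nat.pos_of_ne_zero hp)
        have := i.2
        omega
      subst hp
      refine ⟨0, ?_⟩
      rw [c_zero_of_not_lt K n (fun h' => h (by rw [Fin.lt_def] at h'; omega)), zero_mul]
      exact zero_mem _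

theorem exists_mem_Filt (x : IAlg K n) : ∃ w, x ∈ Filt K n w := by
  have key : ∀ (y : IAlg K n) (w : ℕ), y ∈ Filt K n w → ∃ w', x * y ∈ Filt K n w' := by
    have hx : x ∈ Algebra.adjoin K (Set.range (ι K n)) := by
      rw [adjoin_range_ι]; trivial
    induction hx using Algebra.adjoin_induction with
    | mem x hx =>
      obtain ⟨g, rfl⟩ := hx
      exact fun y w hy => ι_mul_mem g hy
    | algebraMap r =>
      intro y w hy
      exact ⟨w, by rw [← Algebra.smul_def]; exact Submodule.smul_mem _ _ hy⟩
    | add x z _ _ hx hz =>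
      intro y w hy
      obtain ⟨w1, h1⟩ := hx y w hy
      obtain ⟨w2, h2⟩ := hz y w hy
      refine ⟨max w1 w2, ?_⟩
      rw [add_mul]
      exact add_mem (Filt.mono (le_max_left _ _) h1) (Filt.mono (le_max_right _ _) h2)
    | mul x z _ _ hx hz =>
      intro y w hy
      obtain ⟨w1, h1⟩ := hz y w hy
      obtain ⟨w2, h2⟩ := hx _ w1 h1
      exact ⟨w2, by rwa [mul_assoc]⟩
  obtain ⟨w, hw⟩ := key 1 0 (by
    rw [← sum_e]; exact sum_mem fun i _ => (Word.idem 0 i).mem)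
  exact ⟨w, by simpa using hw⟩

end Cyclic

section Differential

variable (K : Type) [Field K] {n : ℕ}

theorem sgn_mul_self (d : ℤ) : sgn K d * sgn K d = 1 := by
  unfold sgn; split_ifs <;> simp

theorem sgn_add (d d' : ℤ) : sgn K (d + d') = sgn K d * sgn K d' := by
  unfold sgn; by_cases h : Even d <;> by_cases h' : Even d' <;> simp [Int.even_add, h, h']

theorem sgn_dg_c (m : Fin n → ℤ) (p : ℕ) (i j : Fin n) :
    sgn K (dg n m (c p i j)) = -(sgn K (m i) * sgn K (m j)) := by
  have h : sgn K (dg n m (c p i j)) = -sgn K (m i + m j) := by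
    have : Even (dg n m (c p i j)) ↔ ¬ Even (m i + m j) := by
      simp [dg, Int.even_sub, Int.even_add, -Int.not_even_iff_odd]; tauto
    unfold sgn; by_cases h : Even (m i + m j) <;> simp [this, h]
  rw [h, sgn_add]

theorem Dval_c (m : Fin n → ℤ) (p : ℕ) (i j : Fin n) :
    Dval K n m (c p i j) =
      ∑ q ∈ Finset.range (p + 1), ∑ r : Fin n, (sgn K (m r) * sgn K (m j)) •
        (ι K n (c (p - q) r j) * ι K n (c q i r))
      + if p = 1 ∧ i = j then ι K n (e i) else 0 := by
  match p with
  | 0 =>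
    simp only [Dval, zero_add, Finset.sum_range_one, sgn_add, zero_ne_one, false_and, if_false,
      add_zero]
    refine Finset.sum_congr rfl fun r _ => ?_
    by_cases h1 : i < r
    · by_cases h2 : r < j
      · simp [h1, h2]
      · simp [h2, c_zero_of_not_lt K n h2]
    · simp [h1, c_zero_of_not_lt K n h1]
  | 1 =>
    simp only [Dval, Finset.sum_range_succ, Finset.sum_range_zero, zero_add, sgn_add, true_and]
    rw [add_comm, ← Finset.sum_add_distrib]
    congr 1
    refine Finset.sum_congr rfl fun r _ => ?_
    congr 1
    · by_cases h1 : i < r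
      · simp [h1]
      · simp [h1, c_zero_of_not_lt K n h1]
    · by_cases h2 : r < j
      · simp [h2]
      · simp [h2, c_zero_of_not_lt K n h2]
  | p + 2 =>
    simp [Dval, sgn_add]

variable [NeZero n] (m : Fin n → ℤ)

/-- The sign attached to the vertex `a` modulo `n`. -/
def vsgn (a : ℕ) : K := sgn K (m (Fin.ofNat n a))

theorem vsgn_mul_self (a : ℕ) : vsgn K m a * vsgn K m a = 1 := sgn_mul_self ..

theorem vsgn_shift (a : ℕ) : vsgn K m (a + n) = vsgn K m a := by
  rw [vsgn, ofNat_add_self, vsgn]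

/-- The value of the differential on `X a b`. -/
def dX (a b : ℕ) : IAlg K n :=
  ∑ r ∈ Finset.Ioo a b, (vsgn K m r * vsgn K m b) • (X K n r b * X K n a r)
    + if b = a + n then E K n a else 0

variable {K m} {D : IAlg K n →ₗ[K] IAlg K n}

theorem IsDiff.map_X (hD : IsDiff K n m D) {a b : ℕ} (hab : a < b) :
    D (X K n a b) = dX K m a b := by
  have hn : 0 < n := Nat.pos_of_neZero n
  have hdiv : a / n ≤ b / n := Nat.div_le_div_right hab.le
  have ha := Nat.mod_add_div a n
  have hb := Nat.mod_add_div b n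
  have hal := Nat.mod_lt a hn
  have hbl := Nat.mod_lt b hn
  rw [X, hD.2.1, Dval_c, dX, Finset.sum_range]
  congr 1
  · set f : ℕ → IAlg K n := fun t =>
      (vsgn K m t * vsgn K m b) • (X K n t b * X K n a t) with hf
    have h1 : ∑ r ∈ Finset.Ioo a b, f r
        = ∑ r ∈ Finset.Ico (n * (a / n)) (n * (a / n) + (b / n - a / n + 1) * n), f r := by
      have hB : n * (a / n) + (b / n - a / n + 1) * n = n * (b / n) + n := by
        rw [add_mul, one_mul, mul_comm _ n, ← add_assoc, ← mul_add,
          Nat.add_sub_cancel' hdiv]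
      rw [hB]
      apply Finset.sum_subset
      · intro t ht
        rw [Finset.mem_Ioo] at ht
        rw [Finset.mem_Ico]
        omega
      · intro t ht ht'
        rw [Finset.mem_Ico] at ht
        rw [Finset.mem_Ioo] at ht'
        have htm := Nat.mod_add_div t n
        have htl := Nat.mod_lt t hn
        have hta : a / n ≤ t / n := (Nat.le_div_iff_mul_le hn).2 (by rw [mul_comm]; exact ht.1)
        have htb : t / n ≤ b / n := by
          have : t / n < b / n + 1 := (Nat.div_lt_iff_lt_mul hn).2 (by
            rw [add_mul, one_mul, mul_comm]; exact ht.2)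
          omega
        by_cases h : a < t
        · have hbt : b ≤ t := by omega
          have : b / n = t / n := le_antisymm (Nat.div_le_div_right hbt) htb
          have hz : X K n t b = 0 := by
            rw [X, this, Nat.sub_self, c_zero_of_not_lt]
            rw [this] at hb
            simp only [Fin.lt_def, Fin.val_ofNat]
            omega
          simp [hf, hz]
        · have : a / n = t / n := le_antisymm hta (Nat.div_le_div_right (by omega))
          have hz : X K n a t = 0 := by
            rw [X, this, Nat.sub_self, c_zero_of_not_lt]
            rw [this] at ha
            simp only [Fin.lt_def, Fin.val_ofNat]
            omega
          simp [hf, hz]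
    rw [h1, Finset.sum_Ico_eq_sum_range, Nat.add_sub_cancel_left, Finset.sum_range,
      ← finProdFinEquiv.sum_comp, Fintype.sum_prod_type]
    refine Finset.sum_congr rfl fun q _ => Finset.sum_congr rfl fun r _ => ?_
    have hval : n * (a / n) + ((finProdFinEquiv (q, r) : Fin _) : ℕ)
        = (r : ℕ) + n * (a / n + q) := by
      simp only [finProdFinEquiv_apply_val]; ring
    rw [hval]
    simp only [hf, vsgn, X, ofNat_add_mul, Nat.add_mul_div_left _ _ hn, Nat.div_eq_of_lt r.2]
    rw [show b / n - (0 + (a / n + (q : ℕ))) = b / n - a / n - q by omega,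
      show 0 + (a / n + (q : ℕ)) - a / n = q by omega]
    simp
  · have : (b / n - a / n = 1 ∧ Fin.ofNat n a = Fin.ofNat n b) ↔ b = a + n := by
      constructor
      · rintro ⟨h, h'⟩
        have h' := congrArg Fin.val h'
        simp only [Fin.val_ofNat] at h'
        have h2 : b / n = a / n + 1 := by omega
        rw [h2, mul_add, mul_one] at hb
        omega
      · rintro rfl
        rw [ofNat_add_self, Nat.add_div_right _ hn]
        simp
    simp only [this, E]

theorem IsDiff.map_X_mul (hD : IsDiff K n m D) {a b : ℕ} (hab : a < b) (y : IAlg K n) :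
    D (X K n a b * y) = dX K m a b * y - (vsgn K m a * vsgn K m b) • (X K n a b * D y) := by
  rw [hD.2.2 (dg n m (c (b / n - a / n) (Fin.ofNat n a) (Fin.ofNat n b))), hD.map_X hab,
    sgn_dg_c]
  · change _ + -(vsgn K m a * vsgn K m b) • (X K n a b * D y) = _
    module
  · exact Submodule.subset_span ⟨[c (b / n - a / n) (Fin.ofNat n a) (Fin.ofNat n b)],
      by simp, by simp [X]⟩

theorem IsDiff.map_E_mul (hD : IsDiff K n m D) (a : ℕ) (y : IAlg K n) :
    D (E K n a * y) = E K n a * D y := by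
  rw [hD.2.2 0, E, hD.1]
  · simp [sgn]
  · exact Submodule.subset_span ⟨[e (Fin.ofNat n a)], by simp [dg], by simp [E]⟩

theorem IsDiff.map_dX (hD : IsDiff K n m D) (a b : ℕ) : D (dX K m a b) = 0 := by
  have h1 : ∀ r ∈ Finset.Ioo a b,
      D ((vsgn K m r * vsgn K m b) • (X K n r b * X K n a r)) =
        ((∑ t ∈ Finset.Ioo r b, (vsgn K m r * vsgn K m t) • (X K n t b * X K n r t * X K n a r))
          - ∑ t ∈ Finset.Ioo a r, (vsgn K m t * vsgn K m r) • (X K n r b * X K n t r * X K n a t))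
        + ((if b = r + n then X K n a r else 0) - if r = a + n then X K n r b else 0) := by
    intro r hr
    rw [Finset.mem_Ioo] at hr
    have hs := vsgn_mul_self K m
    have e2 : (vsgn K m r * vsgn K m b) * (vsgn K m r * vsgn K m b) = 1 := by
      linear_combination (vsgn K m b * vsgn K m b) * hs r + hs b
    rw [map_smul, hD.map_X_mul hr.2, hD.map_X hr.1, smul_sub, smul_smul, e2, one_smul, dX, dX,
      add_mul, mul_add, smul_add, Finset.sum_mul, Finset.mul_sum, Finset.smul_sum]
    have e1 : ∀ t, (vsgn K m r * vsgn K m b) •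
        ((vsgn K m t * vsgn K m b) • (X K n t b * X K n r t) * X K n a r) =
        (vsgn K m r * vsgn K m t) • (X K n t b * X K n r t * X K n a r) := by
      intro t
      rw [smul_mul_assoc, smul_smul]
      congr 1
      linear_combination (vsgn K m r * vsgn K m t) * hs b
    have e3 : ∀ t, X K n r b * ((vsgn K m t * vsgn K m r) • (X K n t r * X K n a t)) =
        (vsgn K m t * vsgn K m r) • (X K n r b * X K n t r * X K n a t) := by
      intro t
      rw [mul_smul_comm, mul_assoc]
    have e4 : (vsgn K m r * vsgn K m b) • ((if b = r + n then E K n r else 0) * X K n a r) =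
        if b = r + n then X K n a r else 0 := by
      split_ifs with h
      · rw [h, vsgn_shift, hs, one_smul, E_mul_X]
      · simp
    have e5 : X K n r b * (if r = a + n then E K n a else 0) =
        if r = a + n then X K n r b else 0 := by
      split_ifs with h
      · rw [← E_shift, ← h, X_mul_E]
      · simp
    simp only [e1, e3, e4, e5]
    abel
  have h2 : ∑ r ∈ Finset.Ioo a b, (if b = r + n then X K n a r else 0) =
      ∑ r ∈ Finset.Ioo a b, (if r = a + n then X K n r b else 0) := by
    have hn : 0 < n := Nat.pos_of_neZero n
    by_cases h : a + n < b
    · rw [Finset.sum_eq_single (b - n), Finset.sum_eq_single (a + n), if_pos rfl, if_pos (by omega)]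
      · have := X_shift K n a (b - n) 1
        rw [mul_one, Nat.sub_add_cancel (by omega)] at this
        exact this.symm
      · intro r _ hr; rw [if_neg hr]
      · intro hr; simp at hr; omega
      · intro r _ hr; rw [if_neg (by omega)]
      · intro hr; simp at hr; omega
    · rw [Finset.sum_eq_zero, Finset.sum_eq_zero] <;>
      · intro r hr
        rw [Finset.mem_Ioo] at hr
        rw [if_neg (by omega)]
  have h3 : ∑ r ∈ Finset.Ioo a b, ∑ t ∈ Finset.Ioo r b,
        (vsgn K m r * vsgn K m t) • (X K n t b * X K n r t * X K n a r) =
      ∑ r ∈ Finset.Ioo a b, ∑ t ∈ Finset.Ioo a r,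
        (vsgn K m t * vsgn K m r) • (X K n r b * X K n t r * X K n a t) := by
    apply Finset.sum_comm'
    intro r t
    simp only [Finset.mem_Ioo]
    omega
  have h4 : D (if b = a + n then E K n a else 0) = 0 := by
    split_ifs
    · exact hD.1 _
    · exact map_zero D
  rw [dX, map_add, map_sum, Finset.sum_congr rfl h1, Finset.sum_add_distrib,
    Finset.sum_sub_distrib, Finset.sum_sub_distrib, h2, h3, h4]
  abel

theorem IsDiff.map_dX_mul (hD : IsDiff K n m D) (a b : ℕ) (y : IAlg K n) :
    D (dX K m a b * y) = (vsgn K m a * vsgn K m b) • (dX K m a b * D y) := by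
  have hs := vsgn_mul_self K m
  have h1 : ∀ r ∈ Finset.Ioo a b,
      D ((vsgn K m r * vsgn K m b) • (X K n r b * X K n a r) * y) =
        D ((vsgn K m r * vsgn K m b) • (X K n r b * X K n a r)) * y
        + (vsgn K m a * vsgn K m b) •
          ((vsgn K m r * vsgn K m b) • (X K n r b * X K n a r) * D y) := by
    intro r hr
    rw [Finset.mem_Ioo] at hr
    have e1 : (vsgn K m r * vsgn K m b) * (vsgn K m a * vsgn K m r) =
        vsgn K m a * vsgn K m b := by
      linear_combination (vsgn K m a * vsgn K m b) * hs r
    have e2 : D (X K n r b * X K n a r * y) = D (X K n r b * X K n a r) * y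
        + (vsgn K m a * vsgn K m b) • (X K n r b * X K n a r * D y) := by
      rw [mul_assoc, hD.map_X_mul hr.2, hD.map_X_mul hr.2, hD.map_X_mul hr.1, hD.map_X hr.1,
        mul_sub, smul_sub, mul_smul_comm, smul_smul, e1, sub_mul, smul_mul_assoc]
      simp only [mul_assoc]
      abel
    rw [smul_mul_assoc, map_smul, map_smul, e2, smul_add, smul_mul_assoc, smul_mul_assoc,
      smul_comm (vsgn K m a * vsgn K m b)]
  have h2 : D ((if b = a + n then E K n a else 0) * y) =
      (vsgn K m a * vsgn K m b) • ((if b = a + n then E K n a else 0) * D y) := by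
    split_ifs with h
    · rw [hD.map_E_mul, h, vsgn_shift, hs, one_smul]
    · simp
  have h3 : D (∑ r ∈ Finset.Ioo a b, (vsgn K m r * vsgn K m b) • (X K n r b * X K n a r)) = 0 := by
    have h := hD.map_dX a b
    rw [dX, map_add] at h
    have h4 : D (if b = a + n then E K n a else 0) = 0 := by
      split_ifs
      · exact hD.1 _
      · exact map_zero D
    rwa [h4, add_zero] at h
  rw [dX, add_mul, map_add, h2, Finset.sum_mul, map_sum, Finset.sum_congr rfl h1,
    Finset.sum_add_distrib, ← Finset.sum_mul, ← map_sum, h3, zero_mul, zero_add,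
    ← Finset.smul_sum, ← Finset.sum_mul, ← smul_add, ← add_mul]

theorem IsDiff.map_map (hD : IsDiff K n m D) (x : IAlg K n) : D (D x) = 0 := by
  obtain ⟨w, hw⟩ := exists_mem_Filt x
  have := map_mem_of_word (P := ⊥) (D ∘ₗ D) (fun u hu => ?_) hw
  · simpa using this
  · rw [Submodule.mem_bot]
    clear hw
    induction hu with
    | idem w i => simp [hD.1]
    | mul hab _ _ ih =>
      simp only [LinearMap.comp_apply] at ih ⊢
      rw [hD.map_X_mul hab, map_sub, map_smul, hD.map_X_mul hab, ih, hD.map_dX_mul, mul_zero,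
        smul_zero, sub_zero, sub_self]

end Differential

section Homotopy

variable {K : Type} [Field K] {n : ℕ} [NeZero n] {m : Fin n → ℤ}
  {D : IAlg K n →ₗ[K] IAlg K n}

/-- `R` lengthens the leftmost generator of a word by one. -/
structure IsRaise (R : IAlg K n →ₗ[K] IAlg K n) : Prop where
  map_e : ∀ i, R (ι K n (e i)) = 0
  map_E_mul : ∀ a y, R (E K n a * y) = E K n (a + 1) * R y
  map_X_mul : ∀ a b y, a < b → R (X K n a b * y) = X K n a (b + 1) * y

variable (m) in
/-- `S` removes, up to sign, a leftmost generator of length one. -/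
structure IsStrip (S : IAlg K n →ₗ[K] IAlg K n) : Prop where
  map_e : ∀ i, S (ι K n (e i)) = 0
  map_X_mul : ∀ a b y, a < b → S (X K n a b * y) =
    if b = a + 1 then (vsgn K m a * vsgn K m b) • (E K n a * y) else 0

variable (m) in
theorem exists_isStrip : ∃ S : IAlg K n →ₗ[K] IAlg K n, IsStrip m S := by
  obtain ⟨S, h1, h2⟩ := exists_strip K n fun i => sgn K (m i) * sgn K (m (i + 1))
  refine ⟨S, h1, fun a b y hab => ?_⟩
  rw [h2 a b y hab]
  split_ifs with h
  · have : Fin.ofNat n a + 1 = Fin.ofNat n b := by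
      rw [h]; ext; simp [Fin.val_add]
    rw [this]; rfl
  · rfl

variable {R S : IAlg K n →ₗ[K] IAlg K n}

theorem IsRaise.map_mem (hR : IsRaise R) {w : ℕ} {x : IAlg K n} (hx : x ∈ Filt K n w) :
    R x ∈ Filt K n (w + 1) := by
  refine map_mem_of_word R (fun u hu => ?_) hx
  cases hu with
  | idem _ i => rw [hR.map_e]; exact zero_mem _
  | mul hab hw hu =>
    rw [hR.map_X_mul _ _ _ hab]
    exact X_mul_mem (by omega) (by omega) hu.mem

theorem IsStrip.map_mem (hS : IsStrip m S) {w : ℕ} {x : IAlg K n} (hx : x ∈ Filt K n w) :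
    S x ∈ Filt K n (w - 1) := by
  refine map_mem_of_word S (fun u hu => ?_) hx
  cases hu with
  | idem _ i => rw [hS.map_e]; exact zero_mem _
  | mul hab hw hu =>
    rw [hS.map_X_mul _ _ _ hab]
    split_ifs
    · exact Submodule.smul_mem _ _ (E_mul_mem _ (Filt.mono (by omega) hu.mem))
    · exact zero_mem _

theorem IsStrip.map_dX_mul (hS : IsStrip m S) {a b : ℕ} (hab : a + 1 < b) (y : IAlg K n) :
    S (dX K m a b * y) = X K n a (b - 1) * y + if b = a + n then S (E K n a * y) else 0 := by
  have hs := vsgn_mul_self K m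
  rw [dX, add_mul, map_add, Finset.sum_mul, map_sum, Finset.sum_eq_single (b - 1)]
  · rw [smul_mul_assoc, map_smul, mul_assoc, hS.map_X_mul _ _ _ (by omega), if_pos (by omega),
      smul_smul, E_mul_X_mul]
    have : vsgn K m (b - 1) * vsgn K m b * (vsgn K m (b - 1) * vsgn K m b) = 1 := by
      linear_combination (vsgn K m b * vsgn K m b) * hs (b - 1) + hs b
    rw [this, one_smul]
    congr 1
    split_ifs <;> simp
  · intro r hr hne
    rw [Finset.mem_Ioo] at hr
    rw [smul_mul_assoc, map_smul, mul_assoc, hS.map_X_mul _ _ _ (by omega), if_neg (by omega),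
      smul_zero]
  · intro h
    simp at h
    omega

theorem IsRaise.map_dX_mul (hR : IsRaise R) {a b : ℕ} (hab : a < b) (y : IAlg K n) :
    R (dX K m a b * y) = (vsgn K m b * vsgn K m (b + 1)) • (dX K m a (b + 1) * y)
      - X K n b (b + 1) * (X K n a b * y)
      + ((if b = a + n then R (E K n a * y) else 0)
        - if b + 1 = a + n then (vsgn K m b * vsgn K m (b + 1)) • (E K n a * y) else 0) := by
  have hs := vsgn_mul_self K m
  have h1 : ∀ r ∈ Finset.Ioo a b,
      R ((vsgn K m r * vsgn K m b) • (X K n r b * X K n a r) * y) =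
      (vsgn K m b * vsgn K m (b + 1)) •
        ((vsgn K m r * vsgn K m (b + 1)) • (X K n r (b + 1) * X K n a r) * y) := by
    intro r hr
    rw [Finset.mem_Ioo] at hr
    rw [smul_mul_assoc, smul_mul_assoc, map_smul, mul_assoc, hR.map_X_mul _ _ _ hr.2, smul_smul,
      mul_assoc (X K n r (b + 1))]
    congr 1
    linear_combination -(vsgn K m r * vsgn K m b) * hs (b + 1)
  have h2 : Finset.Ioo a (b + 1) = insert b (Finset.Ioo a b) := by
    ext r; simp only [Finset.mem_Ioo, Finset.mem_insert]; omega
  have h3 : vsgn K m b * vsgn K m (b + 1) * (vsgn K m b * vsgn K m (b + 1)) = 1 := by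
    linear_combination (vsgn K m b * vsgn K m b) * hs (b + 1) + hs b
  rw [dX, dX, add_mul, map_add, Finset.sum_mul, map_sum, Finset.sum_congr rfl h1,
    ← Finset.smul_sum, ← Finset.sum_mul, h2, Finset.sum_insert (by simp), add_mul, add_mul,
    smul_add, smul_add, smul_mul_assoc, smul_smul, h3, one_smul, ← mul_assoc]
  have h4 : R ((if b = a + n then E K n a else 0) * y) =
      if b = a + n then R (E K n a * y) else 0 := by
    split_ifs <;> simp
  have h5 : (vsgn K m b * vsgn K m (b + 1)) • ((if b + 1 = a + n then E K n a else 0) * y) =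
      if b + 1 = a + n then (vsgn K m b * vsgn K m (b + 1)) • (E K n a * y) else 0 := by
    split_ifs <;> simp
  rw [h4, h5]
  abel

theorem dX_succ (hn : 2 ≤ n) (a : ℕ) : dX K m a (a + 1) = 0 := by
  rw [dX, if_neg (by omega), add_zero]
  apply Finset.sum_eq_zero
  intro r hr
  rw [Finset.mem_Ioo] at hr
  omega

theorem E_mul_dX_mul (hD : IsDiff K n m D) {a b : ℕ} (hab : a < b) (y : IAlg K n) :
    E K n b * (dX K m a b * y) = dX K m a b * y := by
  rw [← mul_assoc, ← hD.map_X hab, ← hD.map_E_mul, E_mul_X]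

theorem homotopy_mem_of_one_lt (hD : IsDiff K n m D) (hn : 2 ≤ n) (hR : IsRaise R)
    (hS : IsStrip m S) {w w' a b : ℕ} {v : IAlg K n} (hab : a + 1 < b) (hw : w + b ≤ w' + a)
    (hv : v ∈ Filt K n w) :
    X K n a b * v - R (S (D (X K n a b * v))) - D (R (S (X K n a b * v))) ∈
      Filt K n (w' - 1) := by
  rw [hS.map_X_mul _ _ _ (by omega), if_neg (by omega), hD.map_X_mul (by omega), map_sub, map_smul,
    hS.map_X_mul _ _ _ (by omega), if_neg (by omega), hS.map_dX_mul hab, smul_zero, sub_zero,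
    map_zero, map_zero, sub_zero, map_add, hR.map_X_mul _ _ _ (by omega),
    Nat.sub_add_cancel (by omega), sub_add_cancel_left]
  apply neg_mem
  split_ifs with h
  · exact Filt.mono (by omega) (hR.map_mem (hS.map_mem (E_mul_mem a hv)))
  · rw [map_zero]; exact zero_mem _

theorem homotopy_mem_of_succ (hD : IsDiff K n m D) (hn : 2 ≤ n) (hR : IsRaise R)
    (hS : IsStrip m S) {w w' c d : ℕ} {v : IAlg K n} (hcd : c < d) (hw : w + d + 1 ≤ w' + c)
    (hv : v ∈ Filt K n w) :
    X K n d (d + 1) * (X K n c d * v) - R (S (D (X K n d (d + 1) * (X K n c d * v))))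
      - D (R (S (X K n d (d + 1) * (X K n c d * v)))) ∈ Filt K n (w' - 1) := by
  have hs := vsgn_mul_self K m
  have h3 : vsgn K m d * vsgn K m (d + 1) * (vsgn K m d * vsgn K m (d + 1)) = 1 := by
    linear_combination (vsgn K m d * vsgn K m d) * hs (d + 1) + hs d
  have h4 : vsgn K m d * vsgn K m (d + 1) * (vsgn K m c * vsgn K m (d + 1)) =
      vsgn K m c * vsgn K m d := by
    linear_combination (vsgn K m c * vsgn K m d) * hs (d + 1)
  have hSD : S (D (X K n d (d + 1) * (X K n c d * v))) =
      (vsgn K m c * vsgn K m d) • (X K n c d * D v) - dX K m c d * v := by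
    rw [hD.map_X_mul (by omega), dX_succ hn, zero_mul, zero_sub, map_neg, map_smul,
      hS.map_X_mul _ _ _ (by omega), if_pos rfl, smul_smul, h3, one_smul, hD.map_X_mul hcd,
      mul_sub, mul_smul_comm, E_mul_X_mul, E_mul_dX_mul hD hcd, neg_sub]
  have hDRS : D (R (S (X K n d (d + 1) * (X K n c d * v)))) =
      (vsgn K m d * vsgn K m (d + 1)) • (dX K m c (d + 1) * v)
        - (vsgn K m c * vsgn K m d) • (X K n c (d + 1) * D v) := by
    rw [hS.map_X_mul _ _ _ (by omega), if_pos rfl, E_mul_X_mul, map_smul, map_smul,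
      hR.map_X_mul _ _ _ hcd, hD.map_X_mul (by omega), smul_sub, smul_smul, h4]
  rw [hSD, hDRS, map_sub, map_smul, hR.map_X_mul _ _ _ hcd, hR.map_dX_mul hcd]
  have hmem : (if d = c + n then R (E K n c * v) else 0)
        - (if d + 1 = c + n then (vsgn K m d * vsgn K m (d + 1)) • (E K n c * v) else 0)
      ∈ Filt K n (w' - 1) := by
    refine sub_mem ?_ ?_ <;> split_ifs
    · exact Filt.mono (by omega) (hR.map_mem (E_mul_mem c hv))
    · exact zero_mem _
    · exact Submodule.smul_mem _ _ (Filt.mono (by omega) (E_mul_mem c hv))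
    · exact zero_mem _
  convert hmem using 1
  abel

theorem homotopy_mem_of_word (hD : IsDiff K n m D) (hn : 2 ≤ n) (hR : IsRaise R)
    (hS : IsStrip m S) {w : ℕ} (hw : 2 ≤ w) {u : IAlg K n} (hu : Word K n w u) :
    u - R (S (D u)) - D (R (S u)) ∈ Filt K n (w - 1) := by
  cases hu with
  | idem _ i =>
    simp only [hD.1, hS.map_e, map_zero, sub_zero]
    exact (Word.idem _ i).mem
  | @mul w₁ _ a b v hab hw₁ hv =>
    obtain hab | rfl : a + 1 < b ∨ b = a + 1 := by omega
    · exact homotopy_mem_of_one_lt hD hn hR hS hab hw₁ hv.mem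
    · cases hv with
      | idem _ i =>
        have h : D (X K n a (a + 1) * ι K n (e i)) = 0 := by
          rw [hD.map_X_mul hab, dX_succ hn, hD.1]; simp
        have h' : R (S (X K n a (a + 1) * ι K n (e i))) = 0 := by
          rw [hS.map_X_mul _ _ _ hab, if_pos rfl, map_smul, hR.map_E_mul, hR.map_e]; simp
        rw [h, h', map_zero, map_zero, map_zero, sub_zero, sub_zero]
        exact X_mul_mem hab (w := 0) (by omega) (Word.idem _ i).mem
      | @mul w₂ _ c d v hcd hw₂ hv =>
        by_cases h : Fin.ofNat n a = Fin.ofNat n d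
        · have hX : X K n a (a + 1) = X K n d (d + 1) := by
            have ha := X_shift K n (a % n) (a % n + 1) (a / n)
            have hd := X_shift K n (d % n) (d % n + 1) (d / n)
            have h := congrArg Fin.val h
            simp only [Fin.val_ofNat] at h
            rw [add_right_comm, Nat.mod_add_div] at ha hd
            rw [ha, hd, h]
          rw [hX]
          exact homotopy_mem_of_succ hD hn hR hS hcd (by omega) hv.mem
        · have h0 : X K n a (a + 1) * (X K n c d * v) = 0 := by
            rw [← X_mul_E K n a, ← E_mul_X_mul K n c d, mul_assoc, ← mul_assoc (E K n a), E, E,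
              e_mul_e_of_ne K n h, zero_mul, mul_zero]
          rw [h0]
          simp

theorem homotopy_mem (hD : IsDiff K n m D) (hn : 2 ≤ n) (hR : IsRaise R)
    (hS : IsStrip m S) {w : ℕ} (hw : 2 ≤ w) {x : IAlg K n} (hx : x ∈ Filt K n w) :
    x - R (S (D x)) - D (R (S x)) ∈ Filt K n (w - 1) :=
  map_mem_of_word (LinearMap.id - R ∘ₗ S ∘ₗ D - D ∘ₗ R ∘ₗ S)
    (fun _ hu => homotopy_mem_of_word hD hn hR hS hw hu) hx

/-- Every cycle is homologous to a combination of words of total length at most one. -/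
theorem exists_eq_add_map (hD : IsDiff K n m D) (hn : 2 ≤ n) {x : IAlg K n} (hx : D x = 0) :
    ∃ a ∈ Filt K n 1, ∃ y, x = a + D y := by
  obtain ⟨R, hR₁, hR₂, hR₃⟩ := exists_raise K n
  obtain ⟨S, hS⟩ := exists_isStrip (K := K) m
  obtain ⟨w, hw⟩ := exists_mem_Filt x
  induction w generalizing x with
  | zero => exact ⟨x, Filt.mono zero_le_one hw, 0, by simp⟩
  | succ w ih =>
    obtain rfl | h : w = 0 ∨ 1 ≤ w := by omega
    · exact ⟨x, hw, 0, by simp⟩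
    · have hmem := homotopy_mem hD hn ⟨hR₁, hR₂, hR₃⟩ hS (by omega) hw
      rw [hx, map_zero, map_zero, sub_zero, Nat.add_sub_cancel] at hmem
      obtain ⟨a, ha, y, hy⟩ := ih (by rw [map_sub, hx, hD.map_map, sub_zero]) hmem
      exact ⟨a, ha, y + R (S x), by rw [map_add, ← add_assoc, ← hy, sub_add_cancel]⟩

/-- The generators of length one are the `c^0_{i,i+1}` and `c^1_{n1}`. -/
theorem X_succ_eq (a : ℕ) :
    (∃ i j : Fin n, (j : ℕ) = i + 1 ∧ X K n a (a + 1) = ι K n (c 0 i j)) ∨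
      ∃ i j : Fin n, (i : ℕ) = n - 1 ∧ (j : ℕ) = 0 ∧ X K n a (a + 1) = ι K n (c 1 i j) := by
  have hn : 0 < n := Nat.pos_of_neZero n
  have ha := X_shift K n (a % n) (a % n + 1) (a / n)
  rw [add_right_comm, Nat.mod_add_div] at ha
  rw [ha]
  have hal := Nat.mod_lt a hn
  by_cases h : a % n + 1 < n
  · exact .inl ⟨⟨a % n, hal⟩, ⟨a % n + 1, h⟩, rfl, by simpa using X_val K n 0 ⟨a % n, hal⟩ ⟨_, h⟩⟩
  · refine .inr ⟨⟨a % n, hal⟩, ⟨0, hn⟩, by dsimp only; omega, rfl, ?_⟩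
    rw [← X_val]
    congr 1
    dsimp only
    omega

end Homotopy

end InternalAlgebra

/-- For `n ≥ 2`, the elements `c^0_{12}, c^0_{23}, …, c^0_{(n−1)n}` and
`c^1_{n1}` of `I_n` are cycles, and the cohomology `H(I_n) = ker ∂ / im ∂` is generated
as a `k_n`-algebra by their cohomology classes: every cycle is, modulo a boundary, an
element of the subalgebra generated over `k_n` by these cycles. -/
theorem statement4 (K : Type) [Field K] (n : ℕ) (hn : 2 ≤ n) (m : Fin n → ℤ)
    (D : IAlg K n →ₗ[K] IAlg K n) (hD : IsDiff K n m D) :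
    (∀ i j : Fin n, (j : ℕ) = (i : ℕ) + 1 → D (ι K n (c 0 i j)) = 0) ∧
    (D (ι K n (c 1 ⟨n - 1, by omega⟩ ⟨0, by omega⟩)) = 0) ∧
    (∀ x : IAlg K n, D x = 0 →
      ∃ a ∈ Algebra.adjoin K
          ({y | ∃ i : Fin n, y = ι K n (e i)}
            ∪ {y | ∃ i j : Fin n, (j : ℕ) = (i : ℕ) + 1 ∧ y = ι K n (c 0 i j)}
            ∪ {ι K n (c 1 ⟨n - 1, by omega⟩ ⟨0, by omega⟩)}),
        ∃ y : IAlg K n, x = a + D y) := by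
  have : NeZero n := ⟨by omega⟩
  refine ⟨?_, ?_, ?_⟩
  · intro i j hij
    have h : X K n i (i + 1) = ι K n (c 0 i j) := by
      simpa [hij] using X_val K n 0 i j
    rw [← h, hD.map_X (Nat.lt_succ_self _), dX_succ hn]
  · have h : X K n (n - 1) (n - 1 + 1) = ι K n (c 1 ⟨n - 1, by omega⟩ ⟨0, by omega⟩) := by
      rw [← X_val]
      congr 1
      dsimp only
      omega
    rw [← h, hD.map_X (Nat.lt_succ_self _), dX_succ hn]
  · intro x hx
    obtain ⟨a, ha, y, hy⟩ := exists_eq_add_map hD hn hx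
    refine ⟨a, ?_, y, hy⟩
    have hle : Filt K n 1 ≤ Subalgebra.toSubmodule (Algebra.adjoin K
          ({y | ∃ i : Fin n, y = ι K n (e i)}
            ∪ {y | ∃ i j : Fin n, (j : ℕ) = (i : ℕ) + 1 ∧ y = ι K n (c 0 i j)}
            ∪ {ι K n (c 1 ⟨n - 1, by omega⟩ ⟨0, by omega⟩)})) := by
      refine Submodule.span_le.2 fun u hu => ?_
      have he : ∀ i : Fin n, ι K n (e i) ∈ Algebra.adjoin K
          ({y | ∃ i : Fin n, y = ι K n (e i)}
            ∪ {y | ∃ i j : Fin n, (j : ℕ) = (i : ℕ) + 1 ∧ y = ι K n (c 0 i j)}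
            ∪ {ι K n (c 1 ⟨n - 1, by omega⟩ ⟨0, by omega⟩)}) :=
        fun i => Algebra.subset_adjoin (.inl (.inl ⟨i, rfl⟩))
      cases hu with
      | idem _ i => exact he i
      | @mul w _ a b v hab hw hv =>
        obtain rfl : b = a + 1 := by omega
        refine Subalgebra.mul_mem _ (Algebra.subset_adjoin ?_) ?_
        · rcases X_succ_eq (K := K) (n := n) a with ⟨i, j, hij, h⟩ | ⟨i, j, hi, hj, h⟩
          · exact .inl (.inr ⟨i, j, hij, h⟩)
          · have hi' : i = ⟨n - 1, by omega⟩ := Fin.ext hi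
            have hj' : j = ⟨0, by omega⟩ := Fin.ext hj
            rw [hi', hj'] at h
            exact .inr h
        · cases hv with
          | idem _ i => exact he i
          | mul => omega
    exact hle ha
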